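/- arXiv:1702.05122 — 6 statements merged into one kernel-verified Lean document; each statement's English description precedes it below -/
import Mathlib

section
/- Let A be a primitive left-stochastic N×N real matrix with Perron eigenvector p and P = diag(p), and assume A satisfies the local balance condition P Aᵀ = A P. Then the matrix B := A P − P + I_N is symmetric, has all entries nonnegative, and is doubly stochastic: every row of B sums to one and every column of B sums to one. -/
open Matrix BigOperators

/-- For a primitive left-stochastic matrix `A` with Perron eigenvector `p`,
`P = diag(p)`, satisfying the local balance condition `P Aᵀ = A P`, the matrix
`B = A P - P + I` is symmetric, entrywise nonnegative, and doubly stochastic. -/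
theorem stmt0 {N : ℕ} (A : Matrix (Fin N) (Fin N) ℝ)
    (hA_nonneg : ∀ i j, 0 ≤ A i j)
    (hA_col : ∀ k, ∑ l, A l k = 1)
    (hA_prim : ∃ n : ℕ, 1 ≤ n ∧ ∀ i j, 0 < (A ^ n) i j)
    (p : Fin N → ℝ)
    (hp_pos : ∀ k, 0 < p k) (hp_sum : ∑ k, p k = 1)
    (hp_eig : A *ᵥ p = p)
    (hbal : Matrix.diagonal p * Aᵀ = A * Matrix.diagonal p) :
    (A * Matrix.diagonal p - Matrix.diagonal p + 1).IsSymm ∧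
    (∀ i j, 0 ≤ (A * Matrix.diagonal p - Matrix.diagonal p + 1) i j) ∧
    (∀ i, ∑ j, (A * Matrix.diagonal p - Matrix.diagonal p + 1) i j = 1) ∧
    (∀ j, ∑ i, (A * Matrix.diagonal p - Matrix.diagonal p + 1) i j = 1) := by
  have hp_le : ∀ k, p k ≤ 1 := fun k => by
    rw [← hp_sum]
    exact Finset.single_le_sum (fun i _ => (hp_pos i).le) (Finset.mem_univ k)
  refine ⟨?_, fun i j => ?_, fun i => ?_, fun j => ?_⟩
  · simp [Matrix.IsSymm, Matrix.transpose_mul, hbal]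
  · have h : 0 ≤ A i j * p j := mul_nonneg (hA_nonneg i j) (hp_pos j).le
    rw [Matrix.add_apply, Matrix.sub_apply, Matrix.mul_diagonal]
    rcases eq_or_ne i j with rfl | hij
    · rw [Matrix.diagonal_apply_eq, Matrix.one_apply_eq]
      linarith [hp_le i]
    · rw [Matrix.diagonal_apply_ne _ hij, Matrix.one_apply_ne hij]
      linarith
  · have h : ∑ j, A i j * p j = p i := congrFun hp_eig i
    simp [Matrix.mul_diagonal, Finset.sum_add_distrib, Finset.sum_sub_distrib, h,
      Matrix.diagonal_apply, Matrix.one_apply]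
  · simp [Matrix.mul_diagonal, Finset.sum_add_distrib, Finset.sum_sub_distrib,
      ← Finset.sum_mul, hA_col, Matrix.diagonal_apply, Matrix.one_apply]
end

section
/- Let A be a primitive left-stochastic N×N real matrix with Perron eigenvector p and P = diag(p), and assume A satisfies the local balance condition P Aᵀ = A P. Then the matrix B := A P − P + I_N is primitive: there exists an integer n ≥ 1 such that every entry of Bⁿ is strictly positive. -/
open Matrix BigOperators

/-- Powers of entrywise nonnegative matrices are monotone with respect to support. -/
theorem Matrix.pow_apply_pos_of_support_subset {ι : Type*} [Fintype ι] [DecidableEq ι]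
    {A B : Matrix ι ι ℝ} (hA : ∀ i j, 0 ≤ A i j) (hB : ∀ i j, 0 ≤ B i j)
    (hAB : ∀ i j, 0 < A i j → 0 < B i j) (n : ℕ) :
    ∀ i j, 0 < (A ^ n) i j → 0 < (B ^ n) i j := by
  induction n with
  | zero => simp
  | succ n ih =>
    intro i j h
    rw [pow_succ, Matrix.mul_apply] at h ⊢
    obtain ⟨k, -, hk⟩ := Finset.exists_lt_of_sum_lt (s := Finset.univ) (f := fun _ => (0 : ℝ))
      (by simpa using h)
    have hAn : 0 ≤ (A ^ n) i k := Matrix.pow_apply_nonneg hA n i k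
    have hAik : 0 < (A ^ n) i k := pos_of_mul_pos_left hk (hA k j)
    have hAkj : 0 < A k j := pos_of_mul_pos_right hk hAn
    exact Finset.sum_pos' (fun l _ => mul_nonneg (Matrix.pow_apply_nonneg hB n i l) (hB l j))
      ⟨k, Finset.mem_univ k, mul_pos (ih i k hAik) (hAB k j hAkj)⟩

/-- For a primitive left-stochastic matrix `A` with Perron eigenvector `p`,
`P = diag(p)`, satisfying the local balance condition `P Aᵀ = A P`, the matrix
`B = A P - P + I` is primitive. -/
theorem stmt1 {N : ℕ} (A : Matrix (Fin N) (Fin N) ℝ)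
    (hA_nonneg : ∀ i j, 0 ≤ A i j)
    (hA_col : ∀ k, ∑ l, A l k = 1)
    (hA_prim : ∃ n : ℕ, 1 ≤ n ∧ ∀ i j, 0 < (A ^ n) i j)
    (p : Fin N → ℝ)
    (hp_pos : ∀ k, 0 < p k) (hp_sum : ∑ k, p k = 1)
    (hp_eig : A *ᵥ p = p)
    (hbal : Matrix.diagonal p * Aᵀ = A * Matrix.diagonal p) :
    ∃ n : ℕ, 1 ≤ n ∧
      ∀ i j, 0 < ((A * Matrix.diagonal p - Matrix.diagonal p + 1) ^ n) i j := by
  obtain ⟨n, hn, hpos⟩ := hA_prim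
  have hp_le (k : Fin N) : p k ≤ 1 :=
    hp_sum ▸ Finset.single_le_sum (fun l _ => (hp_pos l).le) (Finset.mem_univ k)
  have hle (i j : Fin N) :
      A i j * p j ≤ (A * Matrix.diagonal p - Matrix.diagonal p + 1) i j := by
    rw [Matrix.add_apply, Matrix.sub_apply, Matrix.mul_diagonal]
    rcases eq_or_ne i j with rfl | hij
    · rw [Matrix.diagonal_apply_eq, Matrix.one_apply_eq]
      linarith [hp_le i]
    · rw [Matrix.diagonal_apply_ne _ hij, Matrix.one_apply_ne hij]
      linarith
  exact ⟨n, hn, fun i j => Matrix.pow_apply_pos_of_support_subset hA_nonneg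
    (fun k l => (mul_nonneg (hA_nonneg k l) (hp_pos l).le).trans (hle k l))
    (fun k l h => (mul_pos h (hp_pos l)).trans_le (hle k l)) n i j (hpos i j)⟩
end

section
/- Let A be a primitive left-stochastic N×N real matrix with Perron eigenvector p and P = diag(p), and assume A satisfies the local balance condition P Aᵀ = A P. Then the matrix P − A P is symmetric and positive semi-definite: xᵀ(P − A P)x ≥ 0 for every x ∈ ℝ^N. -/
open Matrix BigOperators

/-- Dirichlet form: for a matrix `W` whose row and column sums are both given by `p`,
twice the quadratic form of `diagonal p - W` is `∑ i, ∑ j, W i j * (x i - x j) ^ 2`. -/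
theorem two_mul_dotProduct_diagonal_sub_mulVec {ι : Type*} [Fintype ι] [DecidableEq ι]
    (W : Matrix ι ι ℝ) (p : ι → ℝ) (hrow : ∀ i, ∑ j, W i j = p i) (hcol : ∀ j, ∑ i, W i j = p j)
    (x : ι → ℝ) :
    2 * (x ⬝ᵥ ((Matrix.diagonal p - W) *ᵥ x)) = ∑ i, ∑ j, W i j * (x i - x j) ^ 2 := by
  have h_row : ∑ i, ∑ j, W i j * x i ^ 2 = ∑ i, p i * x i ^ 2 := by
    simp only [← Finset.sum_mul, hrow]
  have h_col : ∑ i, ∑ j, W i j * x j ^ 2 = ∑ j, p j * x j ^ 2 := by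
    rw [Finset.sum_comm]
    simp only [← Finset.sum_mul, hcol]
  have h_quad : x ⬝ᵥ ((Matrix.diagonal p - W) *ᵥ x)
      = ∑ i, p i * x i ^ 2 - ∑ i, ∑ j, W i j * (x i * x j) := by
    rw [sub_mulVec, dotProduct_sub]
    congr 1
    · simp only [dotProduct, mulVec_diagonal]
      exact Finset.sum_congr rfl fun i _ => by ring
    · simp only [dotProduct, mulVec, Finset.mul_sum]
      exact Finset.sum_congr rfl fun i _ => Finset.sum_congr rfl fun j _ => by ring
  have h_expand : ∑ i, ∑ j, W i j * (x i - x j) ^ 2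
      = ∑ i, ∑ j, W i j * x i ^ 2 + ∑ i, ∑ j, W i j * x j ^ 2
        - 2 * ∑ i, ∑ j, W i j * (x i * x j) := by
    simp only [Finset.mul_sum, ← Finset.sum_add_distrib, ← Finset.sum_sub_distrib]
    exact Finset.sum_congr rfl fun i _ => Finset.sum_congr rfl fun j _ => by ring
  rw [h_quad, h_expand, h_row, h_col]
  ring

/-- For a primitive left-stochastic matrix `A` with Perron eigenvector `p`,
`P = diag(p)`, satisfying the local balance condition `P Aᵀ = A P`, the matrix
`P - A P` is symmetric and positive semi-definite. -/
theorem stmt2 {N : ℕ} (A : Matrix (Fin N) (Fin N) ℝ)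
    (hA_nonneg : ∀ i j, 0 ≤ A i j)
    (hA_col : ∀ k, ∑ l, A l k = 1)
    (hA_prim : ∃ n : ℕ, 1 ≤ n ∧ ∀ i j, 0 < (A ^ n) i j)
    (p : Fin N → ℝ)
    (hp_pos : ∀ k, 0 < p k) (hp_sum : ∑ k, p k = 1)
    (hp_eig : A *ᵥ p = p)
    (hbal : Matrix.diagonal p * Aᵀ = A * Matrix.diagonal p) :
    (Matrix.diagonal p - A * Matrix.diagonal p).IsSymm ∧
    ∀ x : Fin N → ℝ, 0 ≤ x ⬝ᵥ ((Matrix.diagonal p - A * Matrix.diagonal p) *ᵥ x) := by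
  refine ⟨?_, fun x => ?_⟩
  · rw [Matrix.IsSymm, transpose_sub, transpose_mul, diagonal_transpose, hbal]
  · have hrow : ∀ i, ∑ j, (A * Matrix.diagonal p) i j = p i := fun i => by
      simp only [mul_diagonal]
      exact congrFun hp_eig i
    have hcol : ∀ j, ∑ i, (A * Matrix.diagonal p) i j = p j := fun j => by
      simp only [mul_diagonal, ← Finset.sum_mul, hA_col, one_mul]
    have h_form := two_mul_dotProduct_diagonal_sub_mulVec _ p hrow hcol x
    have h_nonneg : 0 ≤ ∑ i, ∑ j, (A * Matrix.diagonal p) i j * (x i - x j) ^ 2 :=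
      Finset.sum_nonneg fun i _ => Finset.sum_nonneg fun j _ => by
        rw [mul_diagonal]
        exact mul_nonneg (mul_nonneg (hA_nonneg i j) (hp_pos j).le) (sq_nonneg _)
    linarith
end

section
/- Let A be a primitive left-stochastic N×N real matrix with Perron eigenvector p and P = diag(p), and assume A satisfies the local balance condition P Aᵀ = A P. Then the null space of P − A P is spanned by the all-ones vector: for x ∈ ℝ^N, (P − A P)x = 0 if and only if x = c·𝟙_N for some constant c ∈ ℝ. -/
open Matrix BigOperators

/-- A left fixed vector of a matrix is a left fixed vector of all its powers. -/
theorem vecMul_pow_eq_self {n R : Type*} [Fintype n] [DecidableEq n] [Semiring R]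
    {A : Matrix n n R} {x : n → R} (h : x ᵥ* A = x) (k : ℕ) : x ᵥ* A ^ k = x := by
  induction k with
  | zero => simp
  | succ k ih => rw [pow_succ, ← vecMul_vecMul, ih, h]

/-- A left fixed vector of a matrix with unit column sums, some power of which is entrywise
positive, is constant. -/
theorem eq_const_of_vecMul_eq_self {n : Type*} [Fintype n] [DecidableEq n] [Nonempty n]
    {A : Matrix n n ℝ} (hcol : ∀ j, ∑ i, A i j = 1) {k : ℕ} (hpos : ∀ i j, 0 < (A ^ k) i j)
    {x : n → ℝ} (hx : x ᵥ* A = x) : ∃ c : ℝ, x = fun _ => c := by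
  obtain ⟨m, hm⟩ := Finite.exists_max x
  refine ⟨x m, funext fun i => ?_⟩
  have hconst : (fun _ : n => x m) ᵥ* A = fun _ => x m := by
    ext j
    simp [vecMul, dotProduct, ← Finset.mul_sum, hcol]
  have hfix : ((fun _ => x m) - x) ᵥ* A = (fun _ => x m) - x := by
    rw [sub_vecMul, hconst, hx]
  have hsum : ∑ l, (x m - x l) * (A ^ k) l m = 0 := by
    simpa [vecMul, dotProduct] using congrFun (vecMul_pow_eq_self hfix k) m
  have hzero := (Finset.sum_eq_zero_iff_of_nonneg fun l _ =>
    mul_nonneg (sub_nonneg.2 (hm l)) (hpos l m).le).1 hsum i (Finset.mem_univ i)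
  exact (sub_eq_zero.1 ((mul_eq_zero.1 hzero).resolve_right (hpos i m).ne')).symm

/-- For a primitive left-stochastic matrix `A` with Perron eigenvector `p`,
`P = diag(p)`, satisfying the local balance condition `P Aᵀ = A P`, the null space of
`P - A P` is spanned by the all-ones vector. -/
theorem stmt3 {N : ℕ} (A : Matrix (Fin N) (Fin N) ℝ)
    (hA_nonneg : ∀ i j, 0 ≤ A i j)
    (hA_col : ∀ k, ∑ l, A l k = 1)
    (hA_prim : ∃ n : ℕ, 1 ≤ n ∧ ∀ i j, 0 < (A ^ n) i j)
    (p : Fin N → ℝ)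
    (hp_pos : ∀ k, 0 < p k) (hp_sum : ∑ k, p k = 1)
    (hp_eig : A *ᵥ p = p)
    (hbal : Matrix.diagonal p * Aᵀ = A * Matrix.diagonal p) :
    ∀ x : Fin N → ℝ,
      (Matrix.diagonal p - A * Matrix.diagonal p) *ᵥ x = 0 ↔
      ∃ c : ℝ, x = fun _ => c := by
  intro x
  constructor
  · intro hx
    obtain ⟨n, -, hn⟩ := hA_prim
    have : Nonempty (Fin N) := by
      by_contra h
      rw [not_nonempty_iff] at h
      simp at hp_sum
    refine eq_const_of_vecMul_eq_self hA_col hn (funext fun k => ?_)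
    have hk := congrFun hx k
    rw [← hbal, sub_mulVec, ← mulVec_mulVec, mulVec_transpose] at hk
    simp only [Pi.sub_apply, mulVec_diagonal, Pi.zero_apply, ← mul_sub] at hk
    exact (sub_eq_zero.1 ((mul_eq_zero.1 hk).resolve_left (hp_pos k).ne')).symm
  · rintro ⟨c, rfl⟩
    have hc : diagonal p *ᵥ (fun _ => c) = c • p := by
      ext k
      simp [mulVec_diagonal, mul_comm]
    rw [sub_mulVec, ← mulVec_mulVec, hc, mulVec_smul, hp_eig, sub_self]
end

section
/- Let A be an N×N real matrix, p ∈ ℝ^N a vector with all strictly positive entries, P = diag(p), and assume the local balance condition P Aᵀ = A P. Let V be a real N×N matrix with V·V = (P − A P)/2, and set Ā = (I_N + A)/2. Let g be an arbitrary map from real N×M matrices to real N×M matrices (representing the scaled gradient map M∇J^o), and let W_i, Y_i be real N×M matrices satisfying, for two consecutive indices i−1 and i (with i ≥ 2), the primal–dual exact diffusion recursions W_j = Āᵀ(W_{j−1} − g(W_{j−1})) − P^{-1} V Y_{j−1} and Y_j = Y_{j−1} + V W_j (for j = i−1 and j = i). Then the primal exact diffusion recursion holds at step i: W_i = Āᵀ(2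 W_{i−1} − W_{i−2} − (g(W_{i−1}) − g(W_{i−2}))). -/
open Matrix BigOperators

/-- Under local balance, a square root `V` of `(P - A P) / 2` satisfies `P⁻¹ V² = I - Āᵀ`. -/
theorem inv_diagonal_mul_sq_of_localBalance {n : Type*} [Fintype n] [DecidableEq n]
    {A V : Matrix n n ℝ} {p : n → ℝ} (hp : ∀ k, 0 < p k)
    (hbal : Matrix.diagonal p * Aᵀ = A * Matrix.diagonal p)
    (hV : V * V = (2 : ℝ)⁻¹ • (Matrix.diagonal p - A * Matrix.diagonal p)) :
    (Matrix.diagonal p)⁻¹ * (V * V) = 1 - ((2 : ℝ)⁻¹ • (1 + A))ᵀ := by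
  have hdet : IsUnit (Matrix.diagonal p).det := by
    rw [Matrix.det_diagonal, isUnit_iff_ne_zero]
    exact Finset.prod_ne_zero_iff.2 fun k _ => (hp k).ne'
  rw [hV, ← hbal, Matrix.mul_smul, Matrix.mul_sub, Matrix.nonsing_inv_mul _ hdet,
    Matrix.nonsing_inv_mul_cancel_left _ _ hdet, Matrix.transpose_smul, Matrix.transpose_add,
    Matrix.transpose_one]
  module

/-- Under the local balance condition, the primal–dual form of exact
diffusion implies the primal form
`W_i = Āᵀ (2 W_{i-1} - W_{i-2} - (g(W_{i-1}) - g(W_{i-2})))`. -/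
theorem stmt15 {N M : ℕ} (A : Matrix (Fin N) (Fin N) ℝ)
    (p : Fin N → ℝ) (hp_pos : ∀ k, 0 < p k)
    (hbal : Matrix.diagonal p * Aᵀ = A * Matrix.diagonal p)
    (V : Matrix (Fin N) (Fin N) ℝ)
    (hV_sq : V * V = (2 : ℝ)⁻¹ • (Matrix.diagonal p - A * Matrix.diagonal p))
    (Abar : Matrix (Fin N) (Fin N) ℝ)
    (hAbar : Abar = (2 : ℝ)⁻¹ • ((1 : Matrix (Fin N) (Fin N) ℝ) + A))
    (g : Matrix (Fin N) (Fin M) ℝ → Matrix (Fin N) (Fin M) ℝ)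
    (W Y : ℕ → Matrix (Fin N) (Fin M) ℝ)
    (i : ℕ) (hi : 2 ≤ i)
    (hW1 : W (i - 1) = Abarᵀ * (W (i - 2) - g (W (i - 2))) -
      (Matrix.diagonal p)⁻¹ * V * Y (i - 2))
    (hY1 : Y (i - 1) = Y (i - 2) + V * W (i - 1))
    (hWi : W i = Abarᵀ * (W (i - 1) - g (W (i - 1))) -
      (Matrix.diagonal p)⁻¹ * V * Y (i - 1))
    (hYi : Y i = Y (i - 1) + V * W i) :
    W i = Abarᵀ * ((2 : ℝ) • W (i - 1) - W (i - 2) - (g (W (i - 1)) - g (W (i - 2)))) := by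
  have hkey : (Matrix.diagonal p)⁻¹ * V * (V * W (i - 1)) = W (i - 1) - Abarᵀ * W (i - 1) := by
    rw [← Matrix.mul_assoc, Matrix.mul_assoc _ V V,
      inv_diagonal_mul_sq_of_localBalance hp_pos hbal hV_sq, ← hAbar, Matrix.sub_mul,
      Matrix.one_mul]
  have hdual : (Matrix.diagonal p)⁻¹ * V * Y (i - 2) =
      Abarᵀ * (W (i - 2) - g (W (i - 2))) - W (i - 1) := by
    rw [eq_sub_iff_add_eq', ← eq_sub_iff_add_eq]
    exact hW1
  rw [hWi, hY1, Matrix.mul_add, hkey, hdual]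
  simp only [Matrix.mul_sub, Matrix.mul_smul]
  module
end

section
/- Let A be a primitive left-stochastic N×N real matrix with Perron eigenvector p and P = diag(p), and assume A satisfies the local balance condition P Aᵀ = A P. Then every complex eigenvalue of the matrix Ā := (I_N + A)/2 is real and lies in the interval (0, 1]. -/
open Matrix BigOperators

section Helpers

variable {ι : Type*} [Fintype ι]

/-- The Dirichlet form identity for an eigenvector `p * w` of a left-stochastic matrix
fixing `p`. -/
theorem dirichlet_form_of_eigenvector (M : Matrix ι ι ℝ) (p : ι → ℝ) (w : ι → ℂ) (μ : ℂ)
    (hcol : ∀ k, ∑ l, M l k = 1) (hfix : M *ᵥ p = p)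
    (heig : ∀ l, ∑ k, (M l k : ℂ) * (p k * w k) = μ * (p l * w l)) :
    ∑ l, ∑ k, M l k * p k * Complex.normSq (w l - w k)
      = 2 * (1 - μ.re) * ∑ k, p k * Complex.normSq (w k) := by
  have h1 : ∑ l, ∑ k, M l k * p k * Complex.normSq (w l)
      = ∑ k, p k * Complex.normSq (w k) := by
    refine Finset.sum_congr rfl fun l _ => ?_
    rw [← Finset.sum_mul]
    congr 1
    exact congrFun hfix l
  have h2 : ∑ l, ∑ k, M l k * p k * Complex.normSq (w k)
      = ∑ k, p k * Complex.normSq (w k) := by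
    rw [Finset.sum_comm]
    refine Finset.sum_congr rfl fun k _ => ?_
    simp_rw [mul_assoc]
    rw [← Finset.sum_mul, hcol, one_mul]
  have h3 : ∑ l, ∑ k, M l k * p k * (w l * (starRingEnd ℂ) (w k)).re
      = μ.re * ∑ k, p k * Complex.normSq (w k) := by
    rw [Finset.mul_sum]
    refine Finset.sum_congr rfl fun l _ => ?_
    have h := congrArg (fun x => (x * (starRingEnd ℂ) (w l)).re) (heig l)
    simp only [Finset.sum_mul, Complex.re_sum] at h
    calc _ = ∑ k, ((M l k : ℂ) * (p k * w k) * (starRingEnd ℂ) (w l)).re := by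
          refine Finset.sum_congr rfl fun k _ => ?_
          simp
          ring
      _ = _ := by
          rw [h]
          simp [Complex.normSq_apply]
          ring
  simp only [Complex.normSq_sub, mul_sub, mul_add, Finset.sum_sub_distrib,
    Finset.sum_add_distrib, h1, h2]
  have h4 : ∑ l, ∑ k, M l k * p k * (2 * (w l * (starRingEnd ℂ) (w k)).re)
      = 2 * (μ.re * ∑ k, p k * Complex.normSq (w k)) := by
    rw [← h3]
    simp only [Finset.mul_sum]
    exact Finset.sum_congr rfl fun l _ => Finset.sum_congr rfl fun k _ => by ring
  rw [h4]
  ring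

/-- A balanced matrix has real eigenvalues. -/
theorem eigenvalue_im_eq_zero_of_balanced (M : Matrix ι ι ℝ) (p : ι → ℝ) (w : ι → ℂ) (μ : ℂ)
    (hbal : ∀ l k, M l k * p k = M k l * p l)
    (hw : 0 < ∑ k, p k * Complex.normSq (w k))
    (heig : ∀ l, ∑ k, (M l k : ℂ) * (p k * w k) = μ * (p l * w l)) :
    μ.im = 0 := by
  have h3 : ∑ l, ∑ k, M l k * p k * (w k * (starRingEnd ℂ) (w l)).im
      = μ.im * ∑ k, p k * Complex.normSq (w k) := by
    rw [Finset.mul_sum]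
    refine Finset.sum_congr rfl fun l _ => ?_
    have h := congrArg (fun x => (x * (starRingEnd ℂ) (w l)).im) (heig l)
    simp only [Finset.sum_mul, Complex.im_sum] at h
    calc _ = ∑ k, ((M l k : ℂ) * (p k * w k) * (starRingEnd ℂ) (w l)).im := by
          refine Finset.sum_congr rfl fun k _ => ?_
          simp
          ring
      _ = _ := by
          rw [h]
          simp [Complex.normSq_apply]
          ring
  have h4 : ∑ l, ∑ k, M l k * p k * (w k * (starRingEnd ℂ) (w l)).im
      = -∑ l, ∑ k, M l k * p k * (w k * (starRingEnd ℂ) (w l)).im := by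
    conv_lhs => rw [Finset.sum_comm]
    simp only [← Finset.sum_neg_distrib]
    refine Finset.sum_congr rfl fun l _ => Finset.sum_congr rfl fun k _ => ?_
    rw [hbal k l]
    simp
    ring
  have h5 : μ.im * ∑ k, p k * Complex.normSq (w k) = 0 := by linarith
  exact (mul_eq_zero.mp h5).resolve_right hw.ne'

variable [DecidableEq ι]

theorem sum_pow_apply_eq_one (M : Matrix ι ι ℝ) (hcol : ∀ k, ∑ l, M l k = 1) (n : ℕ) (k : ι) :
    ∑ l, (M ^ n) l k = 1 := by
  induction n generalizing k with
  | zero => simp [Matrix.one_apply]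
  | succ n ih =>
    simp only [pow_succ, Matrix.mul_apply]
    rw [Finset.sum_comm]
    simp_rw [← Finset.sum_mul, ih, one_mul, hcol]

theorem pow_mulVec_of_mulVec_eq_smul {R : Type*} [CommRing R] (M : Matrix ι ι R) (v : ι → R)
    (μ : R) (h : M *ᵥ v = μ • v) (n : ℕ) : (M ^ n) *ᵥ v = μ ^ n • v := by
  induction n with
  | zero => simp
  | succ n ih => rw [pow_succ, ← Matrix.mulVec_mulVec, h, Matrix.mulVec_smul, ih, smul_smul,
      pow_succ, mul_comm]

end Helpers

/-- For a balanced primitive left-stochastic matrix `A`, every complex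
eigenvalue of `Ā = (I + A)/2` is real and lies in `(0, 1]`. -/
theorem stmt18 {N : ℕ} (A : Matrix (Fin N) (Fin N) ℝ)
    (hA_nonneg : ∀ i j, 0 ≤ A i j)
    (hA_col : ∀ k, ∑ l, A l k = 1)
    (hA_prim : ∃ n : ℕ, 1 ≤ n ∧ ∀ i j, 0 < (A ^ n) i j)
    (p : Fin N → ℝ)
    (hp_pos : ∀ k, 0 < p k) (hp_sum : ∑ k, p k = 1)
    (hp_eig : A *ᵥ p = p)
    (hbal : Matrix.diagonal p * Aᵀ = A * Matrix.diagonal p) :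
    ∀ z : ℂ,
      (∃ v : Fin N → ℂ, v ≠ 0 ∧
        (((2 : ℝ)⁻¹ • ((1 : Matrix (Fin N) (Fin N) ℝ) + A)).map Complex.ofReal) *ᵥ v
          = z • v) →
      z.im = 0 ∧ 0 < z.re ∧ z.re ≤ 1 := by
  rintro z ⟨v, hv, hz⟩
  obtain ⟨n, hn, hpos⟩ := hA_prim
  obtain ⟨j, hj⟩ := Function.ne_iff.mp hv
  have hpc : ∀ k, (p k : ℂ) ≠ 0 := fun k => Complex.ofReal_ne_zero.mpr (hp_pos k).ne'
  obtain ⟨w, hw⟩ : ∃ w : Fin N → ℂ, ∀ k, v k = p k * w k :=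
    ⟨fun k => v k / p k, fun k => (mul_div_cancel₀ _ (hpc k)).symm⟩
  have hAv : A.map Complex.ofReal *ᵥ v = (2 * z - 1) • v := by
    have hmap : ((2 : ℝ)⁻¹ • ((1 : Matrix (Fin N) (Fin N) ℝ) + A)).map Complex.ofReal
        = (2 : ℂ)⁻¹ • (1 + A.map Complex.ofReal) := by
      ext i k
      by_cases h : i = k <;> simp [h, mul_add]
    rw [hmap, Matrix.smul_mulVec, Matrix.add_mulVec, Matrix.one_mulVec] at hz
    ext i
    have h := congrFun hz i
    simp only [Pi.smul_apply, Pi.add_apply, smul_eq_mul] at h ⊢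
    linear_combination 2 * h
  set μ : ℂ := 2 * z - 1 with hμ
  have hwpos : 0 < ∑ k, p k * Complex.normSq (w k) := by
    refine Finset.sum_pos' (fun k _ => mul_nonneg (hp_pos k).le (Complex.normSq_nonneg _))
      ⟨j, Finset.mem_univ _, mul_pos (hp_pos j) (Complex.normSq_pos.mpr ?_)⟩
    intro h
    exact hj (by simp [hw, h])
  have heig : ∀ m l, ∑ k, ((A ^ m) l k : ℂ) * (p k * w k) = μ ^ m * (p l * w l) := by
    intro m l
    have h := congrFun (pow_mulVec_of_mulVec_eq_smul _ v μ hAv m) l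
    have hmap : A.map Complex.ofReal ^ m = (A ^ m).map Complex.ofReal :=
      (map_pow Complex.ofRealHom.mapMatrix A m).symm
    rw [hmap] at h
    simpa only [Matrix.mulVec, dotProduct, Matrix.map_apply, Pi.smul_apply, smul_eq_mul, hw]
      using h
  have him : μ.im = 0 := by
    refine eigenvalue_im_eq_zero_of_balanced A p w μ (fun l k => ?_) hwpos
      (by simpa using heig 1)
    have h := congrFun (congrFun hbal l) k
    rw [Matrix.diagonal_mul, Matrix.mul_diagonal, Matrix.transpose_apply] at h
    rw [← h, mul_comm]
  have hμr : μ = (μ.re : ℂ) := Complex.ext rfl (by simpa using him)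
  have hM : ∀ l k, 0 < (A ^ (n + n)) l k := fun l k => by
    rw [pow_add, Matrix.mul_apply]
    exact Finset.sum_pos (fun i _ => mul_pos (hpos l i) (hpos i k)) ⟨l, Finset.mem_univ _⟩
  have hform := dirichlet_form_of_eigenvector (A ^ (n + n)) p w (μ ^ (n + n))
    (sum_pow_apply_eq_one A hA_col _)
    (by simpa using pow_mulVec_of_mulVec_eq_smul A p 1 (by simpa using hp_eig) (n + n))
    (heig _)
  have hre : (μ ^ (n + n)).re = μ.re ^ (n + n) := by
    rw [hμr, ← Complex.ofReal_pow, Complex.ofReal_re, Complex.ofReal_re]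
  rw [hre] at hform
  have hterm : ∀ l k, 0 ≤ (A ^ (n + n)) l k * p k * Complex.normSq (w l - w k) := fun l k =>
    mul_nonneg (mul_pos (hM l k) (hp_pos k)).le (Complex.normSq_nonneg _)
  have hle : μ.re ^ (n + n) ≤ 1 := by
    have h0 := Finset.sum_nonneg fun l (_ : l ∈ Finset.univ) =>
      Finset.sum_nonneg fun k (_ : k ∈ Finset.univ) => hterm l k
    rw [hform] at h0
    have := nonneg_of_mul_nonneg_left h0 hwpos
    linarith
  have heven : Even (n + n) := ⟨n, rfl⟩
  have habs : |μ.re| ≤ 1 := by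
    rw [← heven.pow_abs] at hle
    exact (pow_le_one_iff_of_nonneg (abs_nonneg _) (by omega)).mp hle
  obtain ⟨hlo, hhi⟩ := abs_le.mp habs
  have hne : μ.re ≠ -1 := by
    intro h
    rw [h, heven.neg_one_pow, sub_self, mul_zero, zero_mul] at hform
    have hconst : ∀ k, w k = w j := fun k => by
      have h1 := (Finset.sum_eq_zero_iff_of_nonneg fun l _ =>
        Finset.sum_nonneg fun k _ => hterm l k).mp hform k (Finset.mem_univ _)
      have h2 := (Finset.sum_eq_zero_iff_of_nonneg fun k' _ => hterm k k').mp h1 j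
        (Finset.mem_univ _)
      exact sub_eq_zero.mp (Complex.normSq_eq_zero.mp
        ((mul_eq_zero.mp h2).resolve_left (mul_pos (hM k j) (hp_pos j)).ne'))
    have h1 := heig 1 j
    have h2 : ∑ k, (A j k : ℂ) * p k = p j := by
      exact_mod_cast congrFun hp_eig j
    simp_rw [hconst, ← mul_assoc] at h1
    rw [← Finset.sum_mul, pow_one, pow_one, h2, hμr, h] at h1
    apply hj
    rw [hw]
    push_cast at h1
    simp only [Pi.zero_apply]
    linear_combination h1 / 2
  have hzre : μ.re = 2 * z.re - 1 := by simp [hμ]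
  have hzim : μ.im = 2 * z.im := by simp [hμ]
  have hlt := lt_of_le_of_ne hlo hne.symm
  exact ⟨by linarith, by linarith, by linarith⟩
end
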